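/- Let k be a field, let X be a proper scheme of finite type over k, and let L be a field extension of k. Then every L(t)-point of X is elementarily A¹-equivalent to a constant point: for every k-morphism ξ : Spec L(t) → X there exists a k-morphism x : Spec L → X such that ξ and x ∘ π are elementarily A¹-equivalent L(t)-points of X, where π : Spec L(t) → Spec L is induced by the inclusion L ⊆ L(t). In particular, the natural map X(L)/∼ → X(L(t))/∼ on A¹-equivalence classes of points is surjective. -/

import Mathlib

open AlgebraicGeometry CategoryTheory CategoryTheory.Limits

noncomputable section

/-- The morphism `Spec S ⟶ Spec R` induced by a ring homomorphism `R →+* S`. -/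
def specMapOf {R S : Type} [CommRing R] [CommRing S] (f : R →+* S) :
    Spec (CommRingCat.of S) ⟶ Spec (CommRingCat.of R) :=
  Spec.map (CommRingCat.ofHom f)

/-- Two `M`-points `x₀, x₁` of a `k`-scheme `(X, sX)` (where the `k`-algebra structure of `M`
is recorded by the ring homomorphism `φ : k →+* M`) are *elementarily `𝔸¹`-equivalent* if there
is a `k`-morphism `f : 𝔸¹_M = Spec M[T] ⟶ X` with `f ∘ i₀ = x₀` and `f ∘ i₁ = x₁`, where
`i₀, i₁ : Spec M ⟶ 𝔸¹_M` are the sections induced by evaluation of polynomials at `0` resp. `1`. -/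
def ElemA1Equiv (k : Type) [Field k] (M : Type) [Field M] (φ : k →+* M)
    (X : Scheme) (sX : X ⟶ Spec (CommRingCat.of k))
    (x₀ x₁ : Spec (CommRingCat.of M) ⟶ X) : Prop :=
  ∃ f : Spec (CommRingCat.of (Polynomial M)) ⟶ X,
    f ≫ sX = specMapOf ((Polynomial.C : M →+* Polynomial M).comp φ) ∧
    specMapOf (Polynomial.evalRingHom (0 : M)) ≫ f = x₀ ∧
    specMapOf (Polynomial.evalRingHom (1 : M)) ≫ f = x₁

theorem specMapOf_comp {R S T : Type} [CommRing R] [CommRing S] [CommRing T] (f : R →+* S)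
    (g : S →+* T) : specMapOf g ≫ specMapOf f = specMapOf (g.comp f) := by
  simp only [specMapOf, ← Spec.map_comp, ← CommRingCat.ofHom_comp]

/-- The existence part of the valuative criterion, for a proper morphism. -/
theorem exists_valuative_lift_of_isProper {R K : Type} [CommRing R] [IsDomain R] [ValuationRing R]
    [Field K] [Algebra R K] [IsFractionRing R K] {Y S : Scheme.{0}} (s : Y ⟶ S) [hs : IsProper s]
    (y : Spec (.of K) ⟶ Y) (b : Spec (.of R) ⟶ S)
    (h : y ≫ s = Spec.map (CommRingCat.ofHom (algebraMap R K)) ≫ b) :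
    ∃ l : Spec (.of R) ⟶ Y,
      l ≫ s = b ∧ Spec.map (CommRingCat.ofHom (algebraMap R K)) ≫ l = y := by
  rw [IsProper.eq_valuativeCriterion] at hs
  obtain ⟨⟨l, h₁, h₂⟩⟩ := (hs.1.1.1.existence ⟨R, K, y, b, ⟨h⟩⟩).exists_lift
  exact ⟨l, h₂, h₁⟩

instance isDominant_fromSpecStalk_genericPoint (X : Scheme.{0}) [IrreducibleSpace X] :
    IsDominant (X.fromSpecStalk (genericPoint X)) where
  denseRange := by
    refine (dense_iff_closure_eq.mpr (genericPoint_closure X)).mono ?_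
    rw [Scheme.range_fromSpecStalk, Set.singleton_subset_iff]
    exact specializes_rfl

theorem fromFunctionField_eq_stalkSpecializes_comp {X Y : Scheme.{0}}
    [IrreducibleSpace X] (p : X.PartialMap Y) {x : X} (hx : x ∈ p.domain) : p.fromFunctionField =
      Spec.map (X.presheaf.stalkSpecializes ((genericPoint_spec X).specializes trivial)) ≫
        p.fromSpecStalkOfMem hx := by
  have hs : genericPoint X ⤳ x := (genericPoint_spec X).specializes trivial
  have hx' : genericPoint X ∈ p.domain := hs.mem_open p.domain.2 hx
  change p.domain.fromSpecStalkOfMem _ hx' ≫ p.hom = _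
  rw [Scheme.PartialMap.fromSpecStalkOfMem, ← Category.assoc]
  congr 1
  rw [← cancel_mono p.domain.ι]
  simp

/-- A rational map from an integral scheme whose local rings are valuation rings to a proper
scheme is defined everywhere. -/
theorem exists_extension_of_isProper {X Y S : Scheme.{0}} [IsIntegral X] [Y.IsSeparated]
    [S.IsSeparated] (hval : ∀ x : X, ValuationRing (X.presheaf.stalk x))
    (sX : X ⟶ S) (sY : Y ⟶ S) [IsProper sY]
    (f : Spec X.functionField ⟶ Y)
    (h : f ≫ sY = X.fromSpecStalk (genericPoint X) ≫ sX) :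
    ∃ g : X ⟶ Y, g ≫ sY = sX ∧ X.fromSpecStalk (genericPoint X) ≫ g = f := by
  have hlift : ∀ x : X, ∃ φ : Spec (X.presheaf.stalk x) ⟶ Y,
      φ ≫ sY = X.fromSpecStalk x ≫ sX ∧
      Spec.map (X.presheaf.stalkSpecializes ((genericPoint_spec X).specializes trivial)) ≫ φ
        = f := by
    intro x
    have := hval x
    refine exists_valuative_lift_of_isProper (R := X.presheaf.stalk x) (K := X.functionField)
      sY f _ (h.trans ?_)
    rw [← X.SpecMap_stalkSpecializes_fromSpecStalk
      ((genericPoint_spec X).specializes (trivial : x ∈ _)), Category.assoc]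
    rfl
  choose φ hφ₁ hφ₂ using hlift
  let r : X.RationalMap Y := .ofFunctionField sX sY f h
  have hr : r.fromFunctionField = f := Scheme.RationalMap.fromFunctionField_ofFunctionField _ _ _ _
  have hdom : r.domain = ⊤ := by
    refine top_le_iff.mp fun x _ ↦ Scheme.RationalMap.mem_domain.mpr
      ⟨.ofFromSpecStalk sX sY (φ x) (hφ₁ x),
        Scheme.PartialMap.mem_domain_ofFromSpecStalk .., ?_⟩
    apply Scheme.RationalMap.eq_of_fromFunctionField_eq
    rw [hr, ← hφ₂ x, Scheme.RationalMap.fromFunctionField_toRationalMap,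
      fromFunctionField_eq_stalkSpecializes_comp _
        (Scheme.PartialMap.mem_domain_ofFromSpecStalk sX sY (φ x) (hφ₁ x)),
      Scheme.PartialMap.fromSpecStalkOfMem_ofFromSpecStalk]
  let p := r.toPartialMap
  have hp : p.domain = ⊤ := hdom
  let g : X ⟶ Y := X.topIso.inv ≫ (X.isoOfEq hp).inv ≫ p.hom
  have hpg : p = g.toPartialMap := by
    refine Scheme.PartialMap.ext _ _ hp ?_
    simp only [g, Scheme.Hom.toPartialMap_hom, Iso.hom_inv_id_assoc]
    exact ((X.isoOfEq hp).hom_inv_id_assoc p.hom).symm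
  have hg : X.fromSpecStalk (genericPoint X) ≫ g = f := by
    rw [← hr, ← r.toRationalMap_toPartialMap, ← Scheme.PartialMap.fromSpecStalkOfMem_toPartialMap]
    change _ = p.toRationalMap.fromFunctionField
    rw [hpg]
    rfl
  exact ⟨g, ext_of_isDominant (X.fromSpecStalk (genericPoint X))
    (by rw [← Category.assoc, hg, h]), hg⟩

/-- A localization of a Dedekind domain at a prime ideal is a valuation ring. -/
theorem valuationRing_of_isLocalization_atPrime {R A : Type} [CommRing R] [IsDedekindDomain R]
    [CommRing A] [IsDomain A] [Algebra R A] (P : Ideal R) [P.IsPrime]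
    [IsLocalization.AtPrime A P] : ValuationRing A := by
  have : IsDedekindDomain A := IsLocalization.AtPrime.isDedekindDomain R P A
  have : IsLocalRing A := IsLocalization.AtPrime.isLocalRing A P
  infer_instance

theorem valuationRing_stalk_Spec (R : Type) [CommRing R] [IsDedekindDomain R]
    (x : Spec (.of R)) : ValuationRing ((Spec (.of R)).presheaf.stalk x) :=
  have : x.asIdeal.IsPrime := PrimeSpectrum.isPrime x
  let _ : Algebra R ((Spec (.of R)).presheaf.stalk x) := StructureSheaf.stalkAlgebra R x
  have : IsLocalization.AtPrime ((Spec (.of R)).presheaf.stalk x) x.asIdeal :=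
    StructureSheaf.IsLocalization.to_stalk R x
  valuationRing_of_isLocalization_atPrime x.asIdeal

/-- If `R` is a Dedekind domain with fraction field `K`, then a `K`-point of a proper scheme
extends to an `R`-point. -/
theorem exists_extension_of_isFractionRing {R K : Type} [CommRing R]
    [IsDedekindDomain R] [Field K] [Algebra R K] [IsFractionRing R K]
    {Y S : Scheme.{0}} [Y.IsSeparated] [S.IsSeparated] (sR : Spec (.of R) ⟶ S) (sY : Y ⟶ S)
    [IsProper sY] (f : Spec (.of K) ⟶ Y)
    (h : f ≫ sY = Spec.map (CommRingCat.ofHom (algebraMap R K)) ≫ sR) :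
    ∃ g : Spec (.of R) ⟶ Y, g ≫ sY = sR ∧
      Spec.map (CommRingCat.ofHom (algebraMap R K)) ≫ g = f := by
  have : IsDomain (CommRingCat.of R) := inferInstanceAs (IsDomain R)
  let F : Type := (Spec (.of R)).functionField
  let _ : Field F := inferInstanceAs (Field (Spec (.of R)).functionField)
  let _ : Algebra R F := instAlgebraCarrierFunctionFieldSpec (.of R)
  have : IsFractionRing R F := functionField_isFractionRing_of_affine (.of R)
  let e : K ≃ₐ[R] F := IsLocalization.algEquiv (nonZeroDivisors R) K F
  let i : Spec (.of F) ≅ Spec (.of K) := Scheme.Spec.mapIso e.toRingEquiv.toCommRingCatIso.op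
  have hi : (Spec (.of R)).fromSpecStalk (genericPoint _) =
      i.hom ≫ Spec.map (CommRingCat.ofHom (algebraMap R K)) := by
    rw [Spec.fromSpecStalk_eq']
    change _ = Spec.map (CommRingCat.ofHom e.toRingEquiv.toRingHom) ≫ _
    rw [← Spec.map_comp, ← CommRingCat.ofHom_comp]
    congr 1
    ext x
    exact (e.commutes x).symm
  obtain ⟨g, hg, hgf⟩ := exists_extension_of_isProper (valuationRing_stalk_Spec R) sR sY
    (i.hom ≫ f) (by rw [hi, Category.assoc, h, Category.assoc])
  refine ⟨g, hg, ?_⟩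
  rw [hi, Category.assoc, cancel_epi] at hgf
  exact hgf

/-- If `X` is a proper `k`-scheme and `L` is a field extension of `k`, then every `L(t)`-point
of `X` is elementarily `𝔸¹`-equivalent to a constant point: for every `k`-morphism
`ξ : Spec L(t) ⟶ X` there is a `k`-morphism `x : Spec L ⟶ X` such that `ξ` and `x ∘ π` are
elementarily `𝔸¹`-equivalent `L(t)`-points of `X`, where `π : Spec L(t) ⟶ Spec L` is induced
by the inclusion `L ⊆ L(t)`. -/
theorem ratFuncPoint_elemA1Equiv_constant_of_proper
    (k : Type) [Field k]
    (X : Scheme) (sX : X ⟶ Spec (CommRingCat.of k)) (hX : IsProper sX)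
    (L : Type) [Field L] [Algebra k L]
    (ξ : Spec (CommRingCat.of (RatFunc L)) ⟶ X)
    (hξ : ξ ≫ sX = specMapOf ((algebraMap L (RatFunc L)).comp (algebraMap k L))) :
    ∃ x : Spec (CommRingCat.of L) ⟶ X,
      x ≫ sX = specMapOf (algebraMap k L) ∧
      ElemA1Equiv k (RatFunc L) ((algebraMap L (RatFunc L)).comp (algebraMap k L)) X sX
        ξ (specMapOf (algebraMap L (RatFunc L)) ≫ x) := by
  have : X.IsSeparated := by
    have : IsSeparated (sX ≫ terminal.from (Spec (CommRingCat.of k))) := inferInstance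
    rw [Scheme.isSeparated_iff]
    rwa [terminal.comp_from] at this
  obtain ⟨g, hg, hgξ⟩ := exists_extension_of_isFractionRing (R := Polynomial L) (K := RatFunc L)
    (specMapOf ((Polynomial.C : L →+* Polynomial L).comp (algebraMap k L))) sX ξ (by
      rw [hξ]
      simp only [specMapOf, ← Spec.map_comp, ← CommRingCat.ofHom_comp])
  -- the `L`-morphism `𝔸¹_{L(t)} ⟶ 𝔸¹_L` contracting the generic point `t` at time `0` to the
  -- origin at time `1`
  let ψ : Polynomial L →+* Polynomial (RatFunc L) := Polynomial.eval₂RingHom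
    (Polynomial.C.comp (algebraMap L (RatFunc L))) (Polynomial.C RatFunc.X * (1 - Polynomial.X))
  refine ⟨specMapOf (Polynomial.evalRingHom 0) ≫ g, ?_, specMapOf ψ ≫ g, ?_, ?_, ?_⟩
  · rw [Category.assoc, hg, specMapOf_comp]
    congr 1
    ext a
    simp
  · rw [Category.assoc, hg, specMapOf_comp]
    congr 1
    ext a : 1
    simp [ψ]
  · rw [← hgξ, ← Category.assoc, specMapOf_comp, specMapOf]
    congr 3
    ext a
    · simp [ψ]
    · simp [ψ]
  · rw [← Category.assoc, ← Category.assoc, specMapOf_comp, specMapOf_comp]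
    congr 2
    ext a
    · simp [ψ]
    · simp [ψ]

end
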